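/- If w ∈ S_n is 321-avoiding, then any two reduced words for w are related by a sequence of commutation moves only, i.e., moves replacing a consecutive pair s_i s_j by s_j s_i where |i - j| > 1 (no braid moves are needed). -/

import Mathlib

open Polynomial

/-- The simple transposition `s_i = (i, i+1)` (1-based) in `S_n`, acting on `Fin n`
(0-based positions `i-1` and `i`); equals `1` if `i` is out of range. -/
def gen (n : ℕ) (i : ℕ) : Equiv.Perm (Fin n) :=
  if h : 1 ≤ i ∧ i < n then Equiv.swap ⟨i - 1, by omega⟩ ⟨i, h.2⟩ else 1

/-- Product of the word `l` of generator indices. -/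
def wordProd (n : ℕ) (l : List ℕ) : Equiv.Perm (Fin n) :=
  (l.map (gen n)).prod

/-- Coxeter length of `w ∈ S_n`. -/
noncomputable def len (n : ℕ) (w : Equiv.Perm (Fin n)) : ℕ :=
  sInf {r | ∃ l : List ℕ, (∀ i ∈ l, 1 ≤ i ∧ i < n) ∧ wordProd n l = w ∧ l.length = r}

/-- `l` is a reduced word for `w`. -/
def IsReducedWord (n : ℕ) (w : Equiv.Perm (Fin n)) (l : List ℕ) : Prop :=
  (∀ i ∈ l, 1 ≤ i ∧ i < n) ∧ wordProd n l = w ∧ l.length = len n w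

/-- Bruhat-Chevalley order: `x ≤ w` iff every reduced word for `w` contains a
subword whose product is `x`. -/
def Bruhat (n : ℕ) (x w : Equiv.Perm (Fin n)) : Prop :=
  ∀ l, IsReducedWord n w l → ∃ t, t.Sublist l ∧ wordProd n t = x

/-- `w` is 321-avoiding: no `i < j < k` with `w i > w j > w k`. -/
def Avoids321 (n : ℕ) (w : Equiv.Perm (Fin n)) : Prop :=
  ¬ ∃ i j k : Fin n, i < j ∧ j < k ∧ w j < w i ∧ w k < w j

/-- Product of the subword of `l` selected by the mask `S` (set of selected positions). -/
def maskProd (n : ℕ) (l : List ℕ) (S : Finset ℕ) : Equiv.Perm (Fin n) :=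
  wordProd n (((List.range l.length).filter (fun j => decide (j ∈ S))).map (fun j => l.getD j 0))

/-- Position `j` of the word `l` is a defect of the mask `S`. -/
noncomputable def IsDefect (n : ℕ) (l : List ℕ) (S : Finset ℕ) (j : ℕ) : Prop :=
  len n (maskProd n (l.take j) S * gen n (l.getD j 0)) < len n (maskProd n (l.take j) S)

/-- The defect set `D(σ)` of the mask `S` on the word `l`. -/
noncomputable def defectSet (n : ℕ) (l : List ℕ) (S : Finset ℕ) : Finset ℕ :=
  (Finset.range l.length).filter (fun j =>
    len n (maskProd n (l.take j) S * gen n (l.getD j 0)) < len n (maskProd n (l.take j) S))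

/-- Deodhar's defect generating polynomial `P_x(a) = Σ_{σ : π(w^σ) = x} q^{|D(σ)|}`. -/
noncomputable def defPoly (n : ℕ) (l : List ℕ) (x : Equiv.Perm (Fin n)) : Polynomial ℤ :=
  ∑ S ∈ (Finset.range l.length).powerset,
    if maskProd n l S = x then (X : Polynomial ℤ) ^ (defectSet n l S).card else 0


/-- A single commutation move: exchange a consecutive pair of letters `i, j` with `|i-j| > 1`. -/
def CommMove (l1 l2 : List ℕ) : Prop :=
  ∃ (t1 t2 : List ℕ) (i j : ℕ), (i + 1 < j ∨ j + 1 < i) ∧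
    l1 = t1 ++ i :: j :: t2 ∧ l2 = t1 ++ j :: i :: t2

/-- Inversion set. -/
def invSet (n : ℕ) (w : Equiv.Perm (Fin n)) : Finset (Fin n × Fin n) :=
  Finset.univ.filter (fun p => p.1 < p.2 ∧ w p.2 < w p.1)

theorem mem_invSet (n : ℕ) (w : Equiv.Perm (Fin n)) (a b : Fin n) :
    (a, b) ∈ invSet n w ↔ a < b ∧ w b < w a := by
  simp [invSet]

theorem app_inv (n : ℕ) (w : Equiv.Perm (Fin n)) (a : Fin n) : w (w⁻¹ a) = a :=
  Equiv.apply_symm_apply w a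

def LDesc (n : ℕ) (w : Equiv.Perm (Fin n)) (i : ℕ) : Prop :=
  ∃ h : 1 ≤ i ∧ i < n, w⁻¹ ⟨i, h.2⟩ < w⁻¹ ⟨i - 1, by omega⟩

theorem gen_mul_self (n i : ℕ) : gen n i * gen n i = 1 := by
  unfold gen
  split_ifs
  · exact Equiv.swap_mul_self _ _
  · simp

theorem gen_gen_mul (n i : ℕ) (w : Equiv.Perm (Fin n)) : gen n i * (gen n i * w) = w := by
  rw [← mul_assoc, gen_mul_self, one_mul]

theorem gen_inv (n i : ℕ) : (gen n i)⁻¹ = gen n i :=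
  inv_eq_of_mul_eq_one_left (gen_mul_self n i)

theorem gen_val (n i : ℕ) (h : 1 ≤ i ∧ i < n) (a : Fin n) :
    ((gen n i a : Fin n) : ℕ) = if (a : ℕ) = i - 1 then i else if (a : ℕ) = i then i - 1 else a := by
  unfold gen
  rw [dif_pos h, Equiv.swap_apply_def]
  simp only [Fin.ext_iff]
  split_ifs <;> simp_all

theorem gen_lt (n i : ℕ) (h : 1 ≤ i ∧ i < n) (a b : Fin n)
    (h1 : ¬ ((a : ℕ) = i - 1 ∧ (b : ℕ) = i)) (h2 : ¬ ((a : ℕ) = i ∧ (b : ℕ) = i - 1)) :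
    gen n i a < gen n i b ↔ a < b := by
  rw [Fin.lt_def, Fin.lt_def, gen_val n i h, gen_val n i h]
  split_ifs <;> omega

theorem invSet_desc (n i : ℕ) (w : Equiv.Perm (Fin n)) (hd : LDesc n w i) :
    ∃ p, p ∉ invSet n (gen n i * w) ∧ invSet n w = insert p (invSet n (gen n i * w)) := by
  obtain ⟨h, hd⟩ := hd
  refine ⟨(w⁻¹ ⟨i, h.2⟩, w⁻¹ ⟨i - 1, by omega⟩), ?_, ?_⟩
  · simp only [mem_invSet, Equiv.Perm.mul_apply,
      app_inv, Fin.lt_def, gen_val n i h, not_and]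
    intro _
    split_ifs <;> omega
  · ext ⟨a, b⟩
    simp only [mem_invSet, Equiv.Perm.mul_apply,
      Finset.mem_insert, Prod.mk.injEq, Equiv.Perm.eq_inv_iff_eq]
    by_cases h1 : (w a : ℕ) = i ∧ (w b : ℕ) = i - 1
    · have ha : w a = ⟨i, h.2⟩ := Fin.ext h1.1
      have hb : w b = ⟨i - 1, by omega⟩ := Fin.ext h1.2
      have ha' := Equiv.Perm.eq_inv_iff_eq.2 ha
      have hb' := Equiv.Perm.eq_inv_iff_eq.2 hb
      rw [← ha', ← hb'] at hd
      simp only [ha, hb, hd, true_and, true_or, iff_true, and_self, Fin.lt_def]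
      omega
    · by_cases h2 : (w b : ℕ) = i ∧ (w a : ℕ) = i - 1
      · have ha : w b = ⟨i, h.2⟩ := Fin.ext h2.1
        have hb : w a = ⟨i - 1, by omega⟩ := Fin.ext h2.2
        have ha' := Equiv.Perm.eq_inv_iff_eq.2 ha
        have hb' := Equiv.Perm.eq_inv_iff_eq.2 hb
        rw [← ha', ← hb'] at hd
        simp only [Fin.ext_iff, h1, false_or, not_lt.2 hd.le, false_and]
      · rw [gen_lt n i h _ _ (by tauto) (by tauto)]
        simp only [Fin.ext_iff, h1, false_or]

theorem inv_desc (n i : ℕ) (w : Equiv.Perm (Fin n)) (hd : LDesc n w i) :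
    (invSet n w).card = (invSet n (gen n i * w)).card + 1 := by
  obtain ⟨p, hp, he⟩ := invSet_desc n i w hd
  rw [he, Finset.card_insert_of_notMem hp]

theorem gen_hi (n i : ℕ) (h : 1 ≤ i ∧ i < n) : gen n i ⟨i, h.2⟩ = ⟨i - 1, by omega⟩ := by
  unfold gen; rw [dif_pos h, Equiv.swap_apply_right]

theorem gen_lo (n i : ℕ) (h : 1 ≤ i ∧ i < n) : gen n i ⟨i - 1, by omega⟩ = ⟨i, h.2⟩ := by
  unfold gen; rw [dif_pos h, Equiv.swap_apply_left]

theorem desc_of_not (n i : ℕ) (h : 1 ≤ i ∧ i < n) (w : Equiv.Perm (Fin n)) (hd : ¬ LDesc n w i) :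
    LDesc n (gen n i * w) i := by
  refine ⟨h, ?_⟩
  rw [mul_inv_rev, gen_inv, Equiv.Perm.mul_apply, Equiv.Perm.mul_apply, gen_hi n i h, gen_lo n i h]
  by_contra hc
  apply hd
  refine ⟨h, lt_of_le_of_ne (not_lt.1 hc) ?_⟩
  intro he
  have := w⁻¹.injective he
  simp only [Fin.ext_iff] at this
  omega

theorem inv_not_desc (n i : ℕ) (h : 1 ≤ i ∧ i < n) (w : Equiv.Perm (Fin n)) (hd : ¬ LDesc n w i) :
    (invSet n (gen n i * w)).card = (invSet n w).card + 1 := by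
  have := inv_desc n i _ (desc_of_not n i h w hd)
  rwa [gen_gen_mul] at this

theorem eq_one_of_no_desc (n : ℕ) (w : Equiv.Perm (Fin n)) (hd : ∀ i, ¬ LDesc n w i) : w = 1 := by
  cases n with
  | zero => exact Subsingleton.elim _ _
  | succ m =>
    have hm : StrictMono (w⁻¹ : Equiv.Perm (Fin (m+1))) := by
      rw [Fin.strictMono_iff_lt_succ]
      intro i
      by_contra hc
      apply hd (i + 1)
      refine ⟨⟨by omega, by omega⟩, lt_of_le_of_ne ?_ ?_⟩
      · exact not_lt.1 hc
      · intro he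
        have := w⁻¹.injective he
        simp only [Fin.ext_iff] at this
        omega
    have : ((w⁻¹ : Equiv.Perm (Fin (m+1))) : Fin (m+1) → Fin (m+1)) = id := by
      refine (StrictMono.range_inj hm strictMono_id).1 ?_
      rw [Set.range_id, (w⁻¹).surjective.range_eq]
    have h1 : w⁻¹ = 1 := Equiv.ext (fun x => congrFun this x)
    exact inv_eq_one.1 h1

theorem exists_word (n : ℕ) : ∀ (k : ℕ) (w : Equiv.Perm (Fin n)), (invSet n w).card = k →
    ∃ l : List ℕ, (∀ i ∈ l, 1 ≤ i ∧ i < n) ∧ wordProd n l = w ∧ l.length = k := by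
  intro k
  induction k with
  | zero =>
    intro w hw
    refine ⟨[], by simp, ?_, rfl⟩
    rw [eq_one_of_no_desc n w]
    · simp [wordProd]
    · intro i hi
      have := inv_desc n i w hi
      omega
  | succ k ih =>
    intro w hw
    by_cases hd : ∃ i, LDesc n w i
    · obtain ⟨i, hi⟩ := hd
      have := inv_desc n i w hi
      obtain ⟨l, h1, h2, h3⟩ := ih (gen n i * w) (by omega)
      refine ⟨i :: l, ?_, ?_, by simp [h3]⟩
      · intro j hj
        rcases List.mem_cons.1 hj with rfl | hj
        · exact hi.1
        · exact h1 j hj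
      · have : wordProd n (i :: l) = gen n i * wordProd n l := by simp [wordProd]
        rw [this, h2, gen_gen_mul]
    · push Not at hd
      have := eq_one_of_no_desc n w hd
      subst this
      exfalso
      have : invSet n 1 = ∅ := by
        ext ⟨a, b⟩
        simp only [mem_invSet, Equiv.Perm.one_apply]
        constructor
        · rintro ⟨h1, h2⟩
          exact absurd h1 (not_lt.2 h2.le)
        · simp
      rw [this] at hw
      simp at hw

theorem wordProd_cons (n i : ℕ) (l : List ℕ) : wordProd n (i :: l) = gen n i * wordProd n l := by
  simp [wordProd]

theorem inv_le (n : ℕ) (l : List ℕ) (hl : ∀ i ∈ l, 1 ≤ i ∧ i < n) :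
    (invSet n (wordProd n l)).card ≤ l.length := by
  induction l with
  | nil =>
    have : invSet n (wordProd n []) = ∅ := by
      ext ⟨a, b⟩
      simp only [wordProd, List.map_nil, List.prod_nil, mem_invSet,
        Equiv.Perm.one_apply]
      constructor
      · rintro ⟨h1, h2⟩
        exact absurd h1 (not_lt.2 h2.le)
      · simp
    rw [this]; simp
  | cons i l ih =>
    have ih := ih (fun j hj => hl j (List.mem_cons_of_mem _ hj))
    have hi := hl i (List.mem_cons_self)
    rw [wordProd_cons, List.length_cons]
    by_cases hd : LDesc n (wordProd n l) i
    · have := inv_desc n i _ hd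
      omega
    · have := inv_not_desc n i hi _ hd
      omega

theorem len_eq (n : ℕ) (w : Equiv.Perm (Fin n)) : len n w = (invSet n w).card := by
  apply le_antisymm
  · exact Nat.sInf_le (exists_word n _ w rfl)
  · refine le_csInf ⟨_, exists_word n _ w rfl⟩ ?_
    rintro r ⟨l, h1, rfl, rfl⟩
    exact inv_le n l h1

theorem reduced_cons (n i : ℕ) (w : Equiv.Perm (Fin n)) (l : List ℕ)
    (h : IsReducedWord n w (i :: l)) : LDesc n w i ∧ IsReducedWord n (gen n i * w) l := by
  obtain ⟨h1, h2, h3⟩ := h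
  have hi := h1 i List.mem_cons_self
  have hl : ∀ j ∈ l, 1 ≤ j ∧ j < n := fun j hj => h1 j (List.mem_cons_of_mem _ hj)
  rw [wordProd_cons] at h2
  have h4 : wordProd n l = gen n i * w := by rw [← h2, gen_gen_mul]
  have h5 := inv_le n l hl
  rw [len_eq, List.length_cons] at h3
  rw [h4] at h5
  have hd : LDesc n w i := by
    by_contra hd
    have := inv_not_desc n i hi w hd
    omega
  have := inv_desc n i w hd
  exact ⟨hd, hl, h4, by rw [len_eq]; omega⟩

theorem reduced_cons_of (n i : ℕ) (w : Equiv.Perm (Fin n)) (l : List ℕ) (hd : LDesc n w i)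
    (h : IsReducedWord n (gen n i * w) l) : IsReducedWord n w (i :: l) := by
  obtain ⟨h1, h2, h3⟩ := h
  refine ⟨?_, ?_, ?_⟩
  · intro j hj
    rcases List.mem_cons.1 hj with rfl | hj
    · exact hd.1
    · exact h1 j hj
  · rw [wordProd_cons, h2, gen_gen_mul]
  · rw [len_eq] at h3 ⊢
    rw [inv_desc n i w hd, List.length_cons, h3]

theorem avoids_gen (n i : ℕ) (w : Equiv.Perm (Fin n)) (hd : LDesc n w i) (hw : Avoids321 n w) :
    Avoids321 n (gen n i * w) := by
  obtain ⟨p, hp, he⟩ := invSet_desc n i w hd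
  have key : ∀ a b, a < b → (gen n i * w) b < (gen n i * w) a → w b < w a := by
    intro a b h1 h2
    have : (a, b) ∈ invSet n w := by
      rw [he]
      apply Finset.mem_insert_of_mem
      simp only [mem_invSet]
      exact ⟨h1, h2⟩
    exact ((mem_invSet n w a b).1 this).2
  rintro ⟨a, b, c, h1, h2, h3, h4⟩
  exact hw ⟨a, b, c, h1, h2, key _ _ h1 h3, key _ _ h2 h4⟩

theorem no_adj (n i : ℕ) (w : Equiv.Perm (Fin n)) (hw : Avoids321 n w) (h1 : LDesc n w i)
    (h2 : LDesc n w (i + 1)) : False := by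
  obtain ⟨a, h1⟩ := h1
  obtain ⟨b, h2⟩ := h2
  refine hw ⟨_, _, _, h2, h1, ?_, ?_⟩
  · simp only [app_inv, Fin.lt_def]
    omega
  · simp only [app_inv, Fin.lt_def]
    omega

theorem desc_comm (n i j : ℕ) (w : Equiv.Perm (Fin n)) (hij : i + 1 < j ∨ j + 1 < i)
    (h1 : LDesc n w i) (h2 : LDesc n w j) : LDesc n (gen n i * w) j := by
  obtain ⟨a, h1⟩ := h1
  obtain ⟨b, h2⟩ := h2
  refine ⟨b, ?_⟩
  have e1 : gen n i ⟨j, b.2⟩ = ⟨j, b.2⟩ := by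
    apply Fin.ext
    rw [gen_val n i a]
    simp only
    split_ifs <;> omega
  have e2 : gen n i ⟨j - 1, by omega⟩ = ⟨j - 1, by omega⟩ := by
    apply Fin.ext
    rw [gen_val n i a]
    simp only
    split_ifs <;> omega
  rw [mul_inv_rev, gen_inv, Equiv.Perm.mul_apply, Equiv.Perm.mul_apply, e1, e2]
  exact h2

theorem gen_comm (n i j : ℕ) (hij : i + 1 < j ∨ j + 1 < i) (hi : 1 ≤ i ∧ i < n)
    (hj : 1 ≤ j ∧ j < n) : gen n i * gen n j = gen n j * gen n i := by
  ext a
  simp only [Equiv.Perm.mul_apply, gen_val n i hi, gen_val n j hj]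
  split_ifs <;> omega

theorem move_cons (i : ℕ) (l1 l2 : List ℕ) (h : Relation.ReflTransGen CommMove l1 l2) :
    Relation.ReflTransGen CommMove (i :: l1) (i :: l2) := by
  refine Relation.ReflTransGen.lift (List.cons i) ?_ _ _ h
  rintro x y ⟨t1, t2, a, b, hab, rfl, rfl⟩
  exact ⟨i :: t1, t2, a, b, hab, rfl, rfl⟩

theorem stmt3_aux (n : ℕ) : ∀ (k : ℕ) (w : Equiv.Perm (Fin n)), len n w = k → Avoids321 n w →
    ∀ l1 l2 : List ℕ, IsReducedWord n w l1 → IsReducedWord n w l2 →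
    Relation.ReflTransGen CommMove l1 l2 := by
  intro k
  induction k with
  | zero =>
    intro w hk hw l1 l2 h1 h2
    have e1 := List.length_eq_zero_iff.1 (h1.2.2.trans hk)
    have e2 := List.length_eq_zero_iff.1 (h2.2.2.trans hk)
    subst e1 e2
    exact Relation.ReflTransGen.refl
  | succ k ih =>
    intro w hk hw l1 l2 h1 h2
    obtain ⟨i, t1, rfl⟩ := List.exists_cons_of_length_eq_add_one (h1.2.2.trans hk)
    obtain ⟨j, t2, rfl⟩ := List.exists_cons_of_length_eq_add_one (h2.2.2.trans hk)
    obtain ⟨d1, r1⟩ := reduced_cons n i w t1 h1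
    obtain ⟨d2, r2⟩ := reduced_cons n j w t2 h2
    have lk : ∀ a, LDesc n w a → len n (gen n a * w) = k := by
      intro a ha
      have := inv_desc n a w ha
      rw [len_eq] at hk ⊢
      omega
    have a1 := avoids_gen n i w d1 hw
    have a2 := avoids_gen n j w d2 hw
    by_cases hij : i = j
    · subst hij
      exact move_cons i _ _ (ih _ (lk i d1) a1 _ _ r1 r2)
    · have n1 : j ≠ i + 1 := by
        rintro rfl
        exact no_adj n i w hw d1 d2
      have n2 : i ≠ j + 1 := by
        rintro rfl
        exact no_adj n j w hw d2 d1
      have hfar : i + 1 < j ∨ j + 1 < i := by omega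
      have d12 := desc_comm n i j w hfar d1 d2
      have d21 := desc_comm n j i w hfar.symm d2 d1
      obtain ⟨t, ht1, ht2, ht3⟩ := exists_word n _ (gen n j * (gen n i * w)) rfl
      have rt : IsReducedWord n (gen n j * (gen n i * w)) t := ⟨ht1, ht2, by rw [len_eq, ht3]⟩
      have rt' : IsReducedWord n (gen n i * (gen n j * w)) t := by
        rw [← mul_assoc, gen_comm n i j hfar d1.1 d2.1, mul_assoc]
        exact rt
      have p1 := ih _ (lk i d1) a1 _ _ r1 (reduced_cons_of n j _ t d12 rt)
      have p2 := ih _ (lk j d2) a2 _ _ (reduced_cons_of n i _ t d21 rt') r2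
      refine (move_cons i _ _ p1).trans (Relation.ReflTransGen.head ?_ (move_cons j _ _ p2))
      exact ⟨[], t, i, j, hfar, rfl, rfl⟩

/-- for a 321-avoiding `w`, any two reduced words for `w` are related by a
sequence of commutation moves only. -/
theorem stmt3 (n : ℕ) (w : Equiv.Perm (Fin n)) (hw : Avoids321 n w)
    (l1 l2 : List ℕ) (h1 : IsReducedWord n w l1) (h2 : IsReducedWord n w l2) :
    Relation.ReflTransGen CommMove l1 l2 := by
  exact stmt3_aux n _ w rfl hw l1 l2 h1 h2
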